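/- Let p_e ∈ [0,1] and p_d ∈ [1/2,1). Let Ω = [0,1) × [0,1) with μ the product of two uniform distributions on [0,1), and define φ((u₁,u₁'),(u₂,u₂')) = 1_{u₁⊕u₂ ≤ p_e} · ( 1_{u₁'⊖u₂' ≤ 1/2} + (2p_d−1)·1_{u₁'⊖u₂' > 1/2} ). Then for every digraph D on [3], ∫ ∏_{(i,j)∈A(D)} φ(x_i,x_j) · ∏_{(i,j)∉A(D), i≠j} (1 − φ(x_i,x_j)) dμ³(x₁,x₂,x₃) = p_e^{n_e(D)} (1−p_e)^{3−n_e(D)} (1−p_d)^{n_as(D)} (2p_d−1)^{n_s(D)}; that is, the direction-edge random digraph D(3,p_e,p_d) is the vertex-arc random digraph D(3,Ω,μ,φ). -/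

import Mathlib

open MeasureTheory Finset

/-- A finset of ordered pairs is (the arc set of) a digraph on `Fin n` if it has no loops. -/
def IsDigraph {n : ℕ} (A : Finset (Fin n × Fin n)) : Prop := ∀ p ∈ A, p.1 ≠ p.2

/-- The number of symmetric arc pairs of a digraph. -/
def nS {n : ℕ} (A : Finset (Fin n × Fin n)) : ℕ :=
  (A.filter fun p => (p.2, p.1) ∈ A ∧ p.1 < p.2).card

/-- The number of asymmetric arcs of a digraph. -/
def nAS {n : ℕ} (A : Finset (Fin n × Fin n)) : ℕ :=
  (A.filter fun p => (p.2, p.1) ∉ A).card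

/-- The number of edges of the underlying graph of a digraph. -/
def nE {n : ℕ} (A : Finset (Fin n × Fin n)) : ℕ := nS A + nAS A

/-- Addition modulo 1 on `[0,1)`. -/
noncomputable def oplus (x y : ℝ) : ℝ := if x + y < 1 then x + y else x + y - 1

/-- Subtraction modulo 1 on `[0,1)`. -/
noncomputable def ominus (x y : ℝ) : ℝ := if 0 ≤ x - y then x - y else x - y + 1

/-- The uniform distribution on `[0,1)`. -/
noncomputable def unif : Measure ℝ := volume.restrict (Set.Ico (0 : ℝ) 1)

/-- The probability that the vertex-arc random digraph `D(n, Ω, μ, φ)` equals the digraph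
with arc set `A`. -/
noncomputable def vardP {Ω : Type*} [MeasurableSpace Ω] (μ : Measure Ω) {n : ℕ}
    (φ : Ω → Ω → ℝ) (A : Finset (Fin n × Fin n)) : ℝ :=
  ∫ x : Fin n → Ω,
    (∏ p ∈ A, φ (x p.1) (x p.2)) *
      ∏ p ∈ Finset.univ.filter (fun p : Fin n × Fin n => p.1 ≠ p.2 ∧ p ∉ A),
        (1 - φ (x p.1) (x p.2)) ∂(Measure.pi fun _ : Fin n => μ)

/-- The representative in `[0,1)` of a point of the unit circle. -/
noncomputable def circleFract (t : UnitAddCircle) : ℝ := AddCircle.equivIco 1 0 t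

/-- The indicator of the arc `[0, p]` of the unit circle. -/
noncomputable def arcIndicator (p : ℝ) (t : UnitAddCircle) : ℝ :=
  if circleFract t ≤ p then 1 else 0

/-- The function on the unit circle equal to `1` on `[0, 1/2]` and `-1` on `(1/2, 1)`. -/
noncomputable def halfSign (t : UnitAddCircle) : ℝ :=
  if circleFract t ≤ 1 / 2 then 1 else -1

lemma circleFract_coe (x : ℝ) : circleFract x = Int.fract x := by
  simp [circleFract, AddCircle.coe_equivIco_mk_apply]

lemma exists_coe_eq (t : UnitAddCircle) : ∃ x : ℝ, 0 ≤ x ∧ x < 1 ∧ (x : UnitAddCircle) = t := by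
  refine ⟨AddCircle.equivIco 1 0 t, ?_, ?_, (AddCircle.equivIco 1 0).symm_apply_apply t⟩
  · exact (AddCircle.equivIco 1 0 t).2.1
  · simpa using (AddCircle.equivIco 1 0 t).2.2

@[fun_prop]
lemma measurable_circleFract : Measurable circleFract :=
  (AddCircle.measurableEquivIco 1 0).measurable.subtype_val

@[fun_prop]
lemma measurable_arcIndicator (p : ℝ) : Measurable (arcIndicator p) :=
  Measurable.ite (measurableSet_le (by fun_prop) (by fun_prop)) (by fun_prop) (by fun_prop)

@[fun_prop]
lemma measurable_halfSign : Measurable halfSign :=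
  Measurable.ite (measurableSet_le (by fun_prop) (by fun_prop)) (by fun_prop) (by fun_prop)

lemma arcIndicator_eq_zero_or_one (p : ℝ) (t : UnitAddCircle) :
    arcIndicator p t = 0 ∨ arcIndicator p t = 1 := by
  unfold arcIndicator; split_ifs <;> simp

lemma halfSign_eq_one_or_neg_one (t : UnitAddCircle) : halfSign t = 1 ∨ halfSign t = -1 := by
  unfold halfSign; split_ifs <;> simp

lemma abs_halfSign (t : UnitAddCircle) : |halfSign t| = 1 := by
  rcases halfSign_eq_one_or_neg_one t with h | h <;> simp [h]

lemma ae_ne_zero_and_ne_half :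
    ∀ᵐ t : UnitAddCircle, t ≠ 0 ∧ t ≠ ((1 / 2 : ℝ) : UnitAddCircle) := by
  have h (a : UnitAddCircle) : ∀ᵐ t : UnitAddCircle, t ≠ a := by
    have : volume ({a} : Set UnitAddCircle) = 0 := by
      have h0 := AddCircle.volume_closedBall (1 : ℝ) (x := a) 0
      simpa using h0
    exact measure_eq_zero_iff_ae_notMem.1 this
  exact (h _).and (h _)

lemma halfSign_neg {t : UnitAddCircle}
    (ht : t ≠ 0 ∧ t ≠ ((1 / 2 : ℝ) : UnitAddCircle)) : halfSign (-t) = -halfSign t := by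
  obtain ⟨x, hx0, hx1, rfl⟩ := exists_coe_eq t
  have h0 : x ≠ 0 := fun h => ht.1 (by simp [h])
  have hh : x ≠ 1 / 2 := fun h => ht.2 (by rw [h])
  have hpos : 0 < x := lt_of_le_of_ne hx0 h0.symm
  have hneg : Int.fract (-x) = 1 - x := by
    rw [Int.fract_eq_iff]; exact ⟨by linarith, by linarith, -1, by push_cast; ring⟩
  rw [← AddCircle.coe_neg]
  simp only [halfSign, circleFract_coe, hneg, Int.fract_eq_self.2 ⟨hx0, hx1⟩]
  rcases lt_or_gt_of_ne hh with h | h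
  · rw [if_neg (by linarith), if_pos h.le]
  · rw [if_pos (by linarith), if_neg (by linarith)]; simp

lemma halfSign_half_add {t : UnitAddCircle}
    (ht : t ≠ 0 ∧ t ≠ ((1 / 2 : ℝ) : UnitAddCircle)) :
    halfSign (((1 / 2 : ℝ) : UnitAddCircle) + t) = -halfSign t := by
  obtain ⟨x, hx0, hx1, rfl⟩ := exists_coe_eq t
  have h0 : x ≠ 0 := fun h => ht.1 (by simp [h])
  have hh : x ≠ 1 / 2 := fun h => ht.2 (by rw [h])
  have hpos : 0 < x := lt_of_le_of_ne hx0 h0.symm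
  rw [← AddCircle.coe_add]
  simp only [halfSign, circleFract_coe, Int.fract_eq_self.2 ⟨hx0, hx1⟩]
  rcases lt_or_gt_of_ne hh with h | h
  · rw [Int.fract_eq_self.2 ⟨by linarith, by linarith⟩, if_neg (by linarith), if_pos h.le]
  · have : Int.fract (1 / 2 + x) = x - 1 / 2 := by
      rw [Int.fract_eq_iff]; exact ⟨by linarith, by linarith, 1, by push_cast; ring⟩
    rw [this, if_pos (by linarith), if_neg (by linarith)]; simp

lemma neg_half : -((1 / 2 : ℝ) : UnitAddCircle) = ((1 / 2 : ℝ) : UnitAddCircle) := by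
  rw [neg_eq_iff_add_eq_zero, ← AddCircle.coe_add]
  norm_num

lemma unif_eq_restrict_Ioc : unif = volume.restrict (Set.Ioc (0 : ℝ) 1) :=
  Measure.restrict_congr_set Ico_ae_eq_Ioc

lemma measurePreserving_coe_unif :
    MeasurePreserving (fun x : ℝ => (x : UnitAddCircle)) unif volume := by
  have := UnitAddCircle.measurePreserving_mk 0
  rw [zero_add, ← unif_eq_restrict_Ioc] at this
  exact this

lemma integral_arcIndicator {p : ℝ} (hp0 : 0 ≤ p) (hp1 : p ≤ 1) :
    ∫ t, arcIndicator p t = p := by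
  rw [← measurePreserving_coe_unif.map_eq, integral_map (by fun_prop) (by fun_prop)]
  have h : ∫ x : ℝ, arcIndicator p x ∂unif = ∫ x : ℝ, (Set.Iic p).indicator 1 x ∂unif := by
    refine setIntegral_congr_fun measurableSet_Ico fun x hx => ?_
    simp [arcIndicator, circleFract_coe, Int.fract_eq_self.2 hx, Set.indicator]
  rw [h, integral_indicator_one measurableSet_Iic, unif_eq_restrict_Ioc,
    measureReal_restrict_apply measurableSet_Iic, Set.inter_comm, Set.Ioc_inter_Iic,
    min_eq_right hp1, Real.volume_real_Ioc_of_le hp0, sub_zero]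

lemma isProbabilityMeasure_torus :
    IsProbabilityMeasure (volume : Measure (Fin 3 → UnitAddCircle)) :=
  ⟨by rw [volume_pi, Measure.pi_univ]; simp⟩

/-- The sums `t₀ + t₁`, `t₀ + t₂`, `t₁ + t₂` as an endomorphism of the torus. -/
def pairSums : (Fin 3 → UnitAddCircle) →+ (Fin 3 → UnitAddCircle) where
  toFun t := ![t 0 + t 1, t 0 + t 2, t 1 + t 2]
  map_zero' := by ext i; fin_cases i <;> simp
  map_add' s t := by ext i; fin_cases i <;> simp <;> abel

lemma measurePreserving_pairSums : MeasurePreserving pairSums volume volume := by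
  refine AddMonoidHom.measurePreserving ?_ (fun s => ?_) rfl
  · refine continuous_pi fun i => ?_
    fin_cases i <;> simp [pairSums] <;> fun_prop
  · obtain ⟨x, -, -, hx⟩ := exists_coe_eq (s 0)
    obtain ⟨y, -, -, hy⟩ := exists_coe_eq (s 1)
    obtain ⟨z, -, -, hz⟩ := exists_coe_eq (s 2)
    refine ⟨![((x + y - z) / 2 : ℝ), ((x + z - y) / 2 : ℝ), ((y + z - x) / 2 : ℝ)], ?_⟩
    ext i
    fin_cases i <;> simp only [pairSums, AddMonoidHom.coe_mk, ZeroHom.coe_mk, Fin.zero_eta, Fin.mk_one,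
      Fin.reduceFinMk, Matrix.cons_val, ← AddCircle.coe_add, ← hx, ← hy, ← hz] <;>
      ring_nf

lemma measurePreserving_sub {i j : Fin 3} (hij : i ≠ j) :
    MeasurePreserving (fun t : Fin 3 → UnitAddCircle => t i - t j) volume volume := by
  have := isProbabilityMeasure_torus
  refine AddMonoidHom.measurePreserving (f := Pi.evalAddMonoidHom (fun _ : Fin 3 => UnitAddCircle) i
    - Pi.evalAddMonoidHom (fun _ : Fin 3 => UnitAddCircle) j) ?_ (fun s => ⟨Pi.single i s, ?_⟩) ?_
  · exact (continuous_apply i).sub (continuous_apply j)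
  · simp [hij.symm]
  · simp

lemma ae_sub_ne {i j : Fin 3} (hij : i ≠ j) : ∀ᵐ t : Fin 3 → UnitAddCircle,
    t i - t j ≠ 0 ∧ t i - t j ≠ ((1 / 2 : ℝ) : UnitAddCircle) :=
  (measurePreserving_sub hij).quasiMeasurePreserving.ae ae_ne_zero_and_ne_half

lemma integral_pairSums (f : Fin 3 → UnitAddCircle → ℝ) (hf : ∀ i, Measurable (f i)) :
    ∫ t : Fin 3 → UnitAddCircle, f 0 (t 0 + t 1) * f 1 (t 0 + t 2) * f 2 (t 1 + t 2) =
      (∫ t, f 0 t) * (∫ t, f 1 t) * ∫ t, f 2 t := by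
  have h := integral_fintype_prod_volume_eq_prod f
  have hm : Measurable fun t : Fin 3 → UnitAddCircle => ∏ i, f i (t i) :=
    Finset.measurable_prod _ fun i _ => (hf i).comp (measurable_pi_apply i)
  rw [← measurePreserving_pairSums.map_eq, integral_map
    measurePreserving_pairSums.measurable.aemeasurable hm.aestronglyMeasurable] at h
  simpa [Fin.prod_univ_three, pairSums] using h

lemma integral_eq_zero_of_half_translate (k : Fin 3) (F : (Fin 3 → UnitAddCircle) → ℝ)
    (hF : ∀ᵐ t, F (Pi.single k ((1 / 2 : ℝ) : UnitAddCircle) + t) = -F t) : ∫ t, F t = 0 := by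
  have h := integral_add_left_eq_self (μ := volume) F (Pi.single k ((1 / 2 : ℝ) : UnitAddCircle))
  rw [integral_congr_ae hF, integral_neg] at h
  linarith

lemma integral_eq_zero_of_neg (F : (Fin 3 → UnitAddCircle) → ℝ) (hm : Measurable F)
    (hF : ∀ᵐ t, F (-t) = -F t) : ∫ t, F t = 0 := by
  have hp : MeasurePreserving (fun t : Fin 3 → UnitAddCircle => -t) volume volume :=
    AddMonoidHom.measurePreserving (f := negAddMonoidHom (α := Fin 3 → UnitAddCircle))
      continuous_neg neg_surjective rfl
  have h : ∫ t, F (-t) = ∫ t, F t := by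
    conv_rhs => rw [← hp.map_eq, integral_map hp.measurable.aemeasurable hm.aestronglyMeasurable]
  rw [integral_congr_ae hF, integral_neg] at h
  linarith

lemma integrable_of_bounded (F : (Fin 3 → UnitAddCircle) → ℝ) (hm : Measurable F) (C : ℝ)
    (hC : ∀ t, |F t| ≤ C) : Integrable F :=
  have := isProbabilityMeasure_torus
  Integrable.of_bound hm.aestronglyMeasurable C (ae_of_all _ hC)

lemma integral_affine_halfSign (c d : Fin 3 → ℝ) :
    ∫ t : Fin 3 → UnitAddCircle, (c 0 + d 0 * halfSign (t 0 - t 1)) *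
      (c 1 + d 1 * halfSign (t 0 - t 2)) * (c 2 + d 2 * halfSign (t 1 - t 2)) =
      c 0 * c 1 * c 2 := by
  have := isProbabilityMeasure_torus
  let B (i j : Fin 3) (t : Fin 3 → UnitAddCircle) : ℝ := halfSign (t i - t j)
  have hBm (i j) : Measurable (B i j) := by fun_prop
  have hB (i j t) : |B i j t| ≤ 1 := (abs_halfSign _).le
  have hBint {F : (Fin 3 → UnitAddCircle) → ℝ} (hF : Integrable F) (i j) :
      Integrable fun t => F t * B i j t :=
    hF.mul_bdd (c := 1) (hBm i j).aestronglyMeasurable (ae_of_all _ (hB i j))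
  have hB1 (i j) : Integrable (B i j) := integrable_of_bounded _ (hBm i j) 1 (hB i j)
  let F₀ (t : Fin 3 → UnitAddCircle) : ℝ := d 0 * c 1 * c 2 * B 0 1 t + c 0 * d 1 * c 2 * B 0 2 t
    + d 0 * c 1 * d 2 * (B 0 1 t * B 1 2 t) + c 0 * d 1 * d 2 * (B 0 2 t * B 1 2 t)
  let F₁ (t : Fin 3 → UnitAddCircle) : ℝ := c 0 * c 1 * d 2 * B 1 2 t
    + d 0 * d 1 * c 2 * (B 0 1 t * B 0 2 t)
  let F₂ (t : Fin 3 → UnitAddCircle) : ℝ := d 0 * d 1 * d 2 * (B 0 1 t * B 0 2 t * B 1 2 t)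
  have i₀ : Integrable F₀ := ((((hB1 0 1).const_mul _).add ((hB1 0 2).const_mul _)).add
    ((hBint (hB1 0 1) 1 2).const_mul _)).add ((hBint (hB1 0 2) 1 2).const_mul _)
  have i₁ : Integrable F₁ := ((hB1 1 2).const_mul _).add ((hBint (hB1 0 1) 0 2).const_mul _)
  have i₂ : Integrable F₂ := (hBint (hBint (hB1 0 1) 0 2) 1 2).const_mul _
  have z₀ : ∫ t, F₀ t = 0 := by
    refine integral_eq_zero_of_half_translate 0 _ ?_
    filter_upwards [ae_sub_ne (show (0 : Fin 3) ≠ 1 by decide),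
      ae_sub_ne (show (0 : Fin 3) ≠ 2 by decide)] with t h01 h02
    simp [F₀, B, add_sub_assoc, -one_div, halfSign_half_add h01, halfSign_half_add h02]
    ring
  have z₁ : ∫ t, F₁ t = 0 := by
    refine integral_eq_zero_of_half_translate 1 _ ?_
    filter_upwards [ae_sub_ne (show (0 : Fin 3) ≠ 1 by decide),
      ae_sub_ne (show (1 : Fin 3) ≠ 2 by decide)] with t h01 h12
    have e : t 0 - (((1 / 2 : ℝ) : UnitAddCircle) + t 1) =
        ((1 / 2 : ℝ) : UnitAddCircle) + (t 0 - t 1) := by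
      nth_rw 2 [← neg_half]; abel
    simp [F₁, B, add_sub_assoc, -one_div, e, halfSign_half_add h01, halfSign_half_add h12]
    ring
  have z₂ : ∫ t, F₂ t = 0 := by
    refine integral_eq_zero_of_neg _ (by fun_prop) ?_
    filter_upwards [ae_sub_ne (show (0 : Fin 3) ≠ 1 by decide),
      ae_sub_ne (show (0 : Fin 3) ≠ 2 by decide),
      ae_sub_ne (show (1 : Fin 3) ≠ 2 by decide)] with t h01 h02 h12
    have e (i j) : -t i - -t j = -(t i - t j) := by abel
    simp only [F₂, B, Pi.neg_apply, e, halfSign_neg h01, halfSign_neg h02, halfSign_neg h12]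
    ring
  have hexp (t : Fin 3 → UnitAddCircle) : (c 0 + d 0 * halfSign (t 0 - t 1)) *
      (c 1 + d 1 * halfSign (t 0 - t 2)) * (c 2 + d 2 * halfSign (t 1 - t 2)) =
      c 0 * c 1 * c 2 + F₀ t + F₁ t + F₂ t := by
    simp only [F₀, F₁, F₂, B]; ring
  have j₀ : Integrable fun t => c 0 * c 1 * c 2 + F₀ t := (integrable_const _).add i₀
  have j₁ : Integrable fun t => c 0 * c 1 * c 2 + F₀ t + F₁ t := j₀.add i₁
  simp_rw [hexp]
  rw [integral_add j₁ i₂, integral_add j₀ i₁, integral_add (integrable_const _) i₀, z₀, z₁, z₂]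
  simp

/-- The arc probability given the edge indicator `e` and the direction sign `s`. -/
noncomputable def arcProb (pd e s : ℝ) : ℝ := e * ((1 + s) / 2 + (2 * pd - 1) * ((1 - s) / 2))

/-- The contribution of a pair of vertices to the direction-edge random digraph, where `P` and `Q`
say which of the two arcs are present. -/
noncomputable def pairWeight (pe pd : ℝ) (P Q : Prop) [Decidable P] [Decidable Q] : ℝ :=
  if P ∧ Q then pe * (2 * pd - 1) else if P ∨ Q then pe * (1 - pd) else 1 - pe

lemma exists_pair_factorization (pe pd : ℝ) (P Q : Prop) [Decidable P] [Decidable Q] :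
    ∃ a b c d : ℝ, (a + b * pe) * c = pairWeight pe pd P Q ∧
      ∀ e s : ℝ, (e = 0 ∨ e = 1) → (s = 1 ∨ s = -1) →
        (if P then arcProb pd e s else 1 - arcProb pd e s) *
          (if Q then arcProb pd e (-s) else 1 - arcProb pd e (-s)) = (a + b * e) * (c + d * s) := by
  by_cases hP : P <;> by_cases hQ : Q
  · refine ⟨0, 1, 2 * pd - 1, 0, by simp [pairWeight, hP, hQ], ?_⟩
    rintro e s (rfl | rfl) (rfl | rfl) <;> simp [hP, hQ, arcProb]
  · refine ⟨0, 1, 1 - pd, 1 - pd, by simp [pairWeight, hP, hQ], ?_⟩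
    rintro e s (rfl | rfl) (rfl | rfl) <;> (simp [hP, hQ, arcProb]; try ring)
  · refine ⟨0, 1, 1 - pd, -(1 - pd), by simp [pairWeight, hP, hQ], ?_⟩
    rintro e s (rfl | rfl) (rfl | rfl) <;> (simp [hP, hQ, arcProb]; try ring)
  · refine ⟨1, -1, 1, 0, by simp [pairWeight, hP, hQ]; ring, ?_⟩
    rintro e s (rfl | rfl) (rfl | rfl) <;> simp [hP, hQ, arcProb]

lemma prod_arcs_mul_prod_nonarcs {A : Finset (Fin 3 × Fin 3)} (hA : IsDigraph A)
    (f : Fin 3 × Fin 3 → ℝ) :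
    (∏ p ∈ A, f p) * ∏ p ∈ Finset.univ.filter (fun p : Fin 3 × Fin 3 => p.1 ≠ p.2 ∧ p ∉ A),
        (1 - f p) =
      ((if (0, 1) ∈ A then f (0, 1) else 1 - f (0, 1)) *
        (if (1, 0) ∈ A then f (1, 0) else 1 - f (1, 0))) *
      ((if (0, 2) ∈ A then f (0, 2) else 1 - f (0, 2)) *
        (if (2, 0) ∈ A then f (2, 0) else 1 - f (2, 0))) *
      ((if (1, 2) ∈ A then f (1, 2) else 1 - f (1, 2)) *
        (if (2, 1) ∈ A then f (2, 1) else 1 - f (2, 1))) := by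
  have hA' : A = (Finset.univ.filter fun p : Fin 3 × Fin 3 => p.1 ≠ p.2).filter (· ∈ A) := by
    ext p; simpa using hA p
  have h := Finset.prod_ite (s := Finset.univ.filter fun p : Fin 3 × Fin 3 => p.1 ≠ p.2)
    (p := (· ∈ A)) f (fun p => 1 - f p)
  rw [← hA', Finset.filter_filter] at h
  rw [← h, show (Finset.univ.filter fun p : Fin 3 × Fin 3 => p.1 ≠ p.2) =
    {(0, 1), (1, 0), (0, 2), (2, 0), (1, 2), (2, 1)} by decide]
  simp
  ring_nf

lemma derd_eq_prod_pairWeight (pe pd : ℝ) {A : Finset (Fin 3 × Fin 3)} (hA : IsDigraph A) :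
    pe ^ nE A * (1 - pe) ^ (3 - nE A) * (1 - pd) ^ nAS A * (2 * pd - 1) ^ nS A =
      pairWeight pe pd ((0, 1) ∈ A) ((1, 0) ∈ A) * pairWeight pe pd ((0, 2) ∈ A) ((2, 0) ∈ A) *
        pairWeight pe pd ((1, 2) ∈ A) ((2, 1) ∈ A) := by
  have hd (i : Fin 3) : (i, i) ∉ A := fun h => hA _ h rfl
  have hS : nS A = ∑ p : Fin 3 × Fin 3,
      if p ∈ A ∧ (p.2, p.1) ∈ A ∧ p.1 < p.2 then 1 else 0 := by
    rw [nS, ← Finset.card_filter]; congr 1; ext; simp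
  have hAS : nAS A = ∑ p : Fin 3 × Fin 3, if p ∈ A ∧ (p.2, p.1) ∉ A then 1 else 0 := by
    rw [nAS, ← Finset.card_filter]; congr 1; ext; simp
  simp only [Fintype.sum_prod_type, Fin.sum_univ_three, hd, false_and, if_false] at hS hAS
  rw [nE, hS, hAS]
  simp only [pairWeight]
  by_cases h01 : (0, 1) ∈ A <;> by_cases h10 : (1, 0) ∈ A <;> by_cases h02 : (0, 2) ∈ A <;>
    by_cases h20 : (2, 0) ∈ A <;> by_cases h12 : (1, 2) ∈ A <;> by_cases h21 : (2, 1) ∈ A <;>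
    simp [h01, h10, h02, h20, h12, h21] <;> ring_nf

instance isProbabilityMeasure_unif : IsProbabilityMeasure unif :=
  ⟨by simp [unif]⟩

/-- The projection of three points of the unit square to the two tori of first and second
coordinates. -/
noncomputable def toTori (x : Fin 3 → ℝ × ℝ) :
    (Fin 3 → UnitAddCircle) × (Fin 3 → UnitAddCircle) :=
  (fun i => ((x i).1 : UnitAddCircle), fun i => ((x i).2 : UnitAddCircle))

lemma measurePreserving_toTori :
    MeasurePreserving toTori (Measure.pi fun _ => unif.prod unif) (volume.prod volume) := by
  have h : MeasurePreserving (fun (x : Fin 3 → ℝ) i => (x i : UnitAddCircle))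
      (Measure.pi fun _ => unif) volume :=
    measurePreserving_pi _ _ fun _ => measurePreserving_coe_unif
  exact (h.prod h).comp
    (measurePreserving_arrowProdEquivProdArrow ℝ ℝ (Fin 3) (fun _ => unif) (fun _ => unif))

lemma ae_mem_Ico : ∀ᵐ x : Fin 3 → ℝ × ℝ ∂(Measure.pi fun _ => unif.prod unif),
    ∀ i, (x i).1 ∈ Set.Ico (0 : ℝ) 1 ∧ (x i).2 ∈ Set.Ico (0 : ℝ) 1 := by
  have h : ∀ᵐ u ∂unif, u ∈ Set.Ico (0 : ℝ) 1 := ae_restrict_mem measurableSet_Ico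
  have h2 : ∀ᵐ u ∂(unif.prod unif), u.1 ∈ Set.Ico (0 : ℝ) 1 ∧ u.2 ∈ Set.Ico (0 : ℝ) 1 :=
    (Measure.quasiMeasurePreserving_fst.ae h).and (Measure.quasiMeasurePreserving_snd.ae h)
  exact ae_all_iff.2 fun i => (Measure.quasiMeasurePreserving_eval
    (fun _ : Fin 3 => unif.prod unif) i).ae h2

lemma oplus_eq_fract {x y : ℝ} (hx : x ∈ Set.Ico (0 : ℝ) 1) (hy : y ∈ Set.Ico (0 : ℝ) 1) :
    oplus x y = Int.fract (x + y) := by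
  obtain ⟨hx0, hx1⟩ := hx
  obtain ⟨hy0, hy1⟩ := hy
  symm
  unfold oplus
  split_ifs with h
  · exact Int.fract_eq_self.2 ⟨by linarith, h⟩
  · rw [Int.fract_eq_iff]; exact ⟨by linarith, by linarith, 1, by push_cast; ring⟩

lemma ominus_eq_fract {x y : ℝ} (hx : x ∈ Set.Ico (0 : ℝ) 1) (hy : y ∈ Set.Ico (0 : ℝ) 1) :
    ominus x y = Int.fract (x - y) := by
  obtain ⟨hx0, hx1⟩ := hx
  obtain ⟨hy0, hy1⟩ := hy
  symm
  unfold ominus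
  split_ifs with h
  · exact Int.fract_eq_self.2 ⟨h, by linarith⟩
  · rw [Int.fract_eq_iff]; exact ⟨by linarith, by linarith, -1, by push_cast; ring⟩

lemma arcProb_circle (pe pd : ℝ) {u v : ℝ × ℝ}
    (hu : u.1 ∈ Set.Ico (0 : ℝ) 1 ∧ u.2 ∈ Set.Ico (0 : ℝ) 1)
    (hv : v.1 ∈ Set.Ico (0 : ℝ) 1 ∧ v.2 ∈ Set.Ico (0 : ℝ) 1) :
    (if oplus u.1 v.1 ≤ pe then (1 : ℝ) else 0) *
        ((if ominus u.2 v.2 ≤ 1 / 2 then (1 : ℝ) else 0) +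
          (2 * pd - 1) * (if 1 / 2 < ominus u.2 v.2 then (1 : ℝ) else 0)) =
      arcProb pd (arcIndicator pe ((u.1 : UnitAddCircle) + v.1))
        (halfSign ((u.2 : UnitAddCircle) - v.2)) := by
  rw [← AddCircle.coe_add, ← AddCircle.coe_sub, arcProb, arcIndicator, halfSign, circleFract_coe,
    circleFract_coe, oplus_eq_fract hu.1 hv.1, ominus_eq_fract hu.2 hv.2]
  congr 1
  by_cases h : Int.fract (u.2 - v.2) ≤ 1 / 2
  · rw [if_pos h, if_pos h, if_neg h.not_gt]; norm_num
  · rw [if_neg h, if_neg h, if_pos (not_le.1 h)]; norm_num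

/-- The direction-edge random digraph `D(3, p_e, p_d)` coincides with the vertex-arc random
digraph `D(3, [0,1)², unif × unif, φ)` where
`φ((u₁,u₁'),(u₂,u₂')) = 1_{u₁⊕u₂ ≤ p_e} (1_{u₁'⊖u₂' ≤ 1/2} + (2p_d-1) 1_{u₁'⊖u₂' > 1/2})`. -/
theorem stmt7 {pe pd : ℝ} (hpe0 : 0 ≤ pe) (hpe1 : pe ≤ 1) (hpd0 : 1 / 2 ≤ pd) (hpd1 : pd < 1)
    (φ : ℝ × ℝ → ℝ × ℝ → ℝ)
    (hφ : ∀ u v : ℝ × ℝ, φ u v =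
      (if oplus u.1 v.1 ≤ pe then (1 : ℝ) else 0) *
        ((if ominus u.2 v.2 ≤ 1 / 2 then (1 : ℝ) else 0) +
          (2 * pd - 1) * (if 1 / 2 < ominus u.2 v.2 then (1 : ℝ) else 0))) :
    ∀ A : Finset (Fin 3 × Fin 3), IsDigraph A →
      vardP (unif.prod unif) φ A =
        pe ^ nE A * (1 - pe) ^ (3 - nE A) * (1 - pd) ^ nAS A * (2 * pd - 1) ^ nS A := by
  intro A hA
  obtain ⟨a₀, b₀, c₀, d₀, hw₀, hf₀⟩ := exists_pair_factorization pe pd ((0, 1) ∈ A) ((1, 0) ∈ A)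
  obtain ⟨a₁, b₁, c₁, d₁, hw₁, hf₁⟩ := exists_pair_factorization pe pd ((0, 2) ∈ A) ((2, 0) ∈ A)
  obtain ⟨a₂, b₂, c₂, d₂, hw₂, hf₂⟩ := exists_pair_factorization pe pd ((1, 2) ∈ A) ((2, 1) ∈ A)
  rw [derd_eq_prod_pairWeight pe pd hA, ← hw₀, ← hw₁, ← hw₂]
  let f (y : Fin 3 → UnitAddCircle) : ℝ := (a₀ + b₀ * arcIndicator pe (y 0 + y 1)) *
    (a₁ + b₁ * arcIndicator pe (y 0 + y 2)) * (a₂ + b₂ * arcIndicator pe (y 1 + y 2))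
  let g (z : Fin 3 → UnitAddCircle) : ℝ := (c₀ + d₀ * halfSign (z 0 - z 1)) *
    (c₁ + d₁ * halfSign (z 0 - z 2)) * (c₂ + d₂ * halfSign (z 1 - z 2))
  have hne : ∀ᵐ x : Fin 3 → ℝ × ℝ ∂(Measure.pi fun _ => unif.prod unif),
      ∀ i j, i ≠ j → (toTori x).2 i - (toTori x).2 j ≠ 0 ∧
        (toTori x).2 i - (toTori x).2 j ≠ ((1 / 2 : ℝ) : UnitAddCircle) := by
    simp_rw [ae_all_iff]
    exact fun i j hij => measurePreserving_toTori.quasiMeasurePreserving.ae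
      (Measure.quasiMeasurePreserving_snd.ae (ae_sub_ne hij))
  have key : ∀ᵐ x : Fin 3 → ℝ × ℝ ∂(Measure.pi fun _ => unif.prod unif),
      (∏ p ∈ A, φ (x p.1) (x p.2)) *
        ∏ p ∈ Finset.univ.filter (fun p : Fin 3 × Fin 3 => p.1 ≠ p.2 ∧ p ∉ A),
          (1 - φ (x p.1) (x p.2)) = f (toTori x).1 * g (toTori x).2 := by
    filter_upwards [ae_mem_Ico, hne] with x hx hxne
    have hφx (i j) : φ (x i) (x j) = arcProb pd (arcIndicator pe ((toTori x).1 i + (toTori x).1 j))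
        (halfSign ((toTori x).2 i - (toTori x).2 j)) := by
      rw [hφ, arcProb_circle pe pd (hx i) (hx j)]; rfl
    have hφx' (i j) (hij : i ≠ j) : φ (x j) (x i) =
        arcProb pd (arcIndicator pe ((toTori x).1 i + (toTori x).1 j))
          (-halfSign ((toTori x).2 i - (toTori x).2 j)) := by
      rw [hφx, add_comm, ← halfSign_neg (hxne i j hij), neg_sub]
    rw [prod_arcs_mul_prod_nonarcs hA fun p => φ (x p.1) (x p.2)]
    simp only
    rw [hφx 0 1, hφx' 0 1 (by decide), hφx 0 2, hφx' 0 2 (by decide), hφx 1 2,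
      hφx' 1 2 (by decide),
      hf₀ _ _ (arcIndicator_eq_zero_or_one _ _) (halfSign_eq_one_or_neg_one _),
      hf₁ _ _ (arcIndicator_eq_zero_or_one _ _) (halfSign_eq_one_or_neg_one _),
      hf₂ _ _ (arcIndicator_eq_zero_or_one _ _) (halfSign_eq_one_or_neg_one _)]
    simp only [f, g]
    ring
  have hmap : ∫ x, f (toTori x).1 * g (toTori x).2 ∂(Measure.pi fun _ => unif.prod unif) =
      ∫ z, f z.1 * g z.2 ∂(volume.prod volume) := by
    rw [← measurePreserving_toTori.map_eq,
      integral_map measurePreserving_toTori.measurable.aemeasurable (by fun_prop)]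
  have hint (a b : ℝ) : ∫ t, (a + b * arcIndicator pe t) = a + b * pe := by
    have hi : Integrable (arcIndicator pe) := by
      refine Integrable.of_bound (by fun_prop) 1 (ae_of_all _ fun t => ?_)
      rcases arcIndicator_eq_zero_or_one pe t with h | h <;> simp [h]
    rw [integral_add (integrable_const _) (hi.const_mul _), integral_const_mul,
      integral_arcIndicator hpe0 hpe1]
    simp [measureReal_def]
  have hf : ∫ y, f y = (a₀ + b₀ * pe) * (a₁ + b₁ * pe) * (a₂ + b₂ * pe) := by
    have h := integral_pairSums ![fun t => a₀ + b₀ * arcIndicator pe t,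
      fun t => a₁ + b₁ * arcIndicator pe t, fun t => a₂ + b₂ * arcIndicator pe t]
      (fun i => by fin_cases i <;> simp <;> fun_prop)
    simpa [hint] using h
  have hg : ∫ z, g z = c₀ * c₁ * c₂ := by
    simpa using integral_affine_halfSign ![c₀, c₁, c₂] ![d₀, d₁, d₂]
  rw [vardP, integral_congr_ae key, hmap, integral_prod_mul, hf, hg]
  ring
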